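/- arXiv:math/0610785 — 2 statements merged into one kernel-verified Lean document; each statement's English description precedes it below -/
import Mathlib

section
/- Regarding f_{w₁} and f_{w₂} as elements of the spherical Hecke algebra H(Ḡ,λ̄_P), the convolution f_{w₁}*f_{w₂} is supported on the single double coset J̄_P w₁w₂ J̄_P. -/
open Pointwise

section SharedReps

variable {G : Type*} [Group G] {V W : Type*}
  [AddCommGroup V] [Module ℂ V] [AddCommGroup W] [Module ℂ W]

/-- `ρ`, given as a function on `G`, is multiplicative on the subgroup `K`
(a representation of `K` recorded as a function defined on all of `G`). -/
def IsRepOn (K : Subgroup G) (ρ : G → Module.End ℂ V) : Prop :=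
  ρ 1 = 1 ∧ ∀ x ∈ K, ∀ y ∈ K, ρ (x * y) = ρ x * ρ y

/-- `ρ` is an irreducible representation of the subgroup `K`. -/
def IsIrrepOn (K : Subgroup G) (ρ : G → Module.End ℂ V) : Prop :=
  IsRepOn K ρ ∧
    ∀ p : Submodule ℂ V, (∀ x ∈ K, ∀ v ∈ p, ρ x v ∈ p) → p = ⊥ ∨ p = ⊤

/-- Equivalence of two representations on the set `K`. -/
def RepEquivOn (K : Set G) (ρ : G → Module.End ℂ V) (σ : G → Module.End ℂ W) : Prop :=
  ∃ T : V ≃ₗ[ℂ] W, ∀ g ∈ K, ∀ v : V, T (ρ g v) = σ g (T v)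

/-- The space `I_g(ρ)` of operators intertwining `ρ` with its `g`-conjugate
(the intertwining condition is imposed on `K ∩ g⁻¹Kg`). -/
def ISpace (K : Subgroup G) (ρ : G → Module.End ℂ V) (g : G) :
    Submodule ℂ (Module.End ℂ V) where
  carrier := {φ | ∀ x, x ∈ K → g * x * g⁻¹ ∈ K → ρ (g * x * g⁻¹) * φ = φ * ρ x}
  add_mem' := fun ha hb x hx hx' => by
    simp only [mul_add, add_mul, ha x hx hx', hb x hx hx']
  zero_mem' := fun x hx hx' => by simp
  smul_mem' := fun c a ha x hx hx' => by
    simp only [mul_smul_comm, smul_mul_assoc, ha x hx hx']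

/-- `g` intertwines the representation `ρ` of `K`. -/
def Intertwines (K : Subgroup G) (ρ : G → Module.End ℂ V) (g : G) : Prop :=
  ISpace K ρ g ≠ ⊥

/-- The part of the intertwining set of the representation `ρ` of `K` lying in `S`. -/
def ISet (S : Set G) (K : Subgroup G) (ρ : G → Module.End ℂ V) : Set G :=
  {g ∈ S | Intertwines K ρ g}

/-- `θ` is a (one-dimensional) character of `H`. -/
def IsCharOn (H : Subgroup G) (θ : G → ℂ) : Prop :=
  θ 1 = 1 ∧ ∀ x ∈ H, ∀ y ∈ H, θ (x * y) = θ x * θ y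

/-- The one-dimensional representation attached to a character. -/
noncomputable def charRep (θ : G → ℂ) : G → Module.End ℂ ℂ := fun g => θ g • 1

/-- The representation `ρ` contains the character `θ` of `H`. -/
def ContainsChar (H : Subgroup G) (θ : G → ℂ) (ρ : G → Module.End ℂ V) : Prop :=
  ∃ v : V, v ≠ 0 ∧ ∀ x ∈ H, ρ x v = θ x • v

/-- The space of `K`-homomorphisms between two representations. -/
def HomSpace (K : Subgroup G) (ρ : G → Module.End ℂ V) (σ : G → Module.End ℂ W) :
    Submodule ℂ (V →ₗ[ℂ] W) where
  carrier := {φ | ∀ x ∈ K, ∀ v : V, φ (ρ x v) = σ x (φ v)}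
  add_mem' := fun ha hb x hx v => by simp [ha x hx v, hb x hx v]
  zero_mem' := fun x hx v => by simp
  smul_mem' := fun c φ hφ x hx v => by simp [hφ x hx v]

end SharedReps

/-- Abstract model of the `λ`-spherical Hecke algebra `H(G,λ)` attached to a pair `(J,λ)`:
an associative unital `ℂ`-algebra `𝓗` equipped with a support map into subsets of `G`,
satisfying the standard support formalism (supports are unions of `(J,J)`-double cosets,
the unit is supported on `J`, and convolution shrinks supports). -/
structure HeckeData (G : Type*) [Group G] (J : Subgroup G)
    (𝓗 : Type*) [Ring 𝓗] [Algebra ℂ 𝓗] where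
  supp : 𝓗 → Set G
  supp_one : supp 1 ⊆ (J : Set G)
  supp_zero : supp 0 = ∅
  eq_zero_of_supp : ∀ f, supp f = ∅ → f = 0
  supp_add : ∀ f g, supp (f + g) ⊆ supp f ∪ supp g
  supp_smul : ∀ (c : ℂ) f, supp (c • f) ⊆ supp f
  supp_mul : ∀ f g, supp (f * g) ⊆ supp f * supp g
  supp_biinvariant : ∀ f, (J : Set G) * supp f * (J : Set G) = supp f ∨ supp f = ∅

namespace HeckeData

variable {G : Type*} [Group G] {J : Subgroup G} {𝓗 : Type*} [Ring 𝓗] [Algebra ℂ 𝓗]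

/-- The submodule of elements of the Hecke algebra supported in the subset `S`. -/
def suppIn (hd : HeckeData G J 𝓗) (S : Set G) : Submodule ℂ 𝓗 where
  carrier := {f | hd.supp f ⊆ S}
  add_mem' := fun ha hb => (hd.supp_add _ _).trans (Set.union_subset ha hb)
  zero_mem' := by
    show hd.supp 0 ⊆ S
    rw [hd.supp_zero]; exact Set.empty_subset S
  smul_mem' := fun c f hf => (hd.supp_smul c f).trans hf

/-- The subalgebra of elements of the Hecke algebra supported in a subgroup `K ⊇ J`. -/
def suppSubalgebra (hd : HeckeData G J 𝓗) (K : Subgroup G) (hJK : J ≤ K) :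
    Subalgebra ℂ 𝓗 where
  carrier := {f | hd.supp f ⊆ (K : Set G)}
  mul_mem' := fun {a b} ha hb => (hd.supp_mul a b).trans (by
    intro x hx
    rcases Set.mem_mul.mp hx with ⟨y, hy, z, hz, rfl⟩
    exact K.mul_mem (ha hy) (hb hz))
  add_mem' := fun {a b} ha hb => (hd.supp_add a b).trans (Set.union_subset ha hb)
  one_mem' := hd.supp_one.trans (fun x hx => hJK hx)
  zero_mem' := by
    show hd.supp 0 ⊆ (K : Set G)
    rw [hd.supp_zero]; exact Set.empty_subset _
  algebraMap_mem' := fun c => by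
    show hd.supp (algebraMap ℂ 𝓗 c) ⊆ (K : Set G)
    rw [Algebra.algebraMap_eq_smul_one]
    exact (hd.supp_smul c 1).trans (hd.supp_one.trans (fun x hx => hJK hx))

end HeckeData

/-!
Lemma 2.10 of Goldberg–Kutzko–Stevens.

`f_{w₁}, f_{w₂}` are the elements of the spherical Hecke algebra `H(Ḡ,λ̄_P)` of
Lemma 2.9, supported on the double cosets `J̄_P w₁ J̄_P`, `J̄_P w₂ J̄_P`.  The key
group-theoretic facts are that `J̄_P` has an Iwahori decomposition with respect to the
Siegel parabolic `P̄ = L̄Ū` (with opposite unipotent radical `Ū₋`) and that `J̄_P`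
contains `w₁(J̄_P∩Ū₋)w₁⁻¹`, `w₁(J̄_P∩L̄)w₁⁻¹` and `w₂⁻¹(J̄_P∩Ū)w₂`.

Conclusion: the convolution `f_{w₁} * f_{w₂}` is supported on `J̄_P w₁w₂ J̄_P`.
-/
theorem lemma_2_10
    {G : Type*} [Group G]
    -- the group `J̄_P` and the Levi decomposition data `L̄`, `Ū`, `Ū₋`
    (JP L U Um : Subgroup G)
    (w1 w2 : G)
    -- the spherical Hecke algebra `H(Ḡ,λ̄_P)`
    {𝓗 : Type*} [Ring 𝓗] [Algebra ℂ 𝓗] (hd : HeckeData G JP 𝓗)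
    (fw1 fw2 : 𝓗)
    (hfw1 : hd.supp fw1 ⊆ (JP : Set G) * {w1} * (JP : Set G))
    (hfw2 : hd.supp fw2 ⊆ (JP : Set G) * {w2} * (JP : Set G))
    -- Iwahori decomposition of `J̄_P` with respect to `(L̄, P̄)`
    (hIw : (JP : Set G) ⊆
      ((JP ⊓ Um : Subgroup G) : Set G) * ((JP ⊓ L : Subgroup G) : Set G) *
        ((JP ⊓ U : Subgroup G) : Set G))
    -- `J̄_P` contains `w₁(J̄_P∩Ū₋)w₁⁻¹`, `w₁(J̄_P∩L̄)w₁⁻¹` and `w₂⁻¹(J̄_P∩Ū)w₂`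
    (hc1 : ∀ x ∈ JP ⊓ Um, w1 * x * w1⁻¹ ∈ JP)
    (hc2 : ∀ x ∈ JP ⊓ L, w1 * x * w1⁻¹ ∈ JP)
    (hc3 : ∀ x ∈ JP ⊓ U, w2⁻¹ * x * w2 ∈ JP) :
    hd.supp (fw1 * fw2) ⊆ (JP : Set G) * {w1 * w2} * (JP : Set G) := by
  refine (hd.supp_mul fw1 fw2).trans ((Set.mul_subset_mul hfw1 hfw2).trans ?_)
  rintro _ ⟨_, ⟨_, ⟨a, ha, w1, rfl, rfl⟩, b, hb, rfl⟩, _,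
    ⟨_, ⟨c, hc, w2, rfl, rfl⟩, d, hd', rfl⟩, rfl⟩
  obtain ⟨_, ⟨m, hm, l, hl, rfl⟩, u, hu, hbc⟩ := hIw (JP.mul_mem hb hc)
  refine ⟨_, ⟨_, JP.mul_mem ha (JP.mul_mem (hc1 m hm) (hc2 l hl)), _, rfl, rfl⟩,
    _, JP.mul_mem (hc3 u hu) hd', ?_⟩
  have hbc' : b * c = m * l * u := hbc.symm
  calc _ = a * w1 * (m * l * u) * w2 * d := by group
    _ = _ := by rw [← hbc']; group
end

section
/- Let ζ = w₁w₂ and f_ζ = f_{w₁}*f_{w₂} ∈ H(Ḡ,λ̄_P). Then for each positive integer k, the k-fold convolution power f_ζ^k is supported on the single double coset J̄_P ζ^k J̄_P. -/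
open Pointwise

/-!
Lemma 2.13 of Goldberg–Kutzko–Stevens.

`ζ = w₁w₂` and `f_ζ = f_{w₁} * f_{w₂} ∈ H(Ḡ,λ̄_P)` is supported on `J̄_P ζ J̄_P`
(Lemma 2.10).  The key group-theoretic facts are the Iwahori decomposition of `J̄_P`
with respect to the Siegel parabolic `P̄ = L̄Ū` and that `J̄_P` contains
`ζ(J̄_P∩Ū₋)ζ⁻¹`, `ζ(J̄_P∩L̄)ζ⁻¹` and `ζ^{-k}(J̄_P∩Ū)ζ^k` for all `k ≥ 0`.

Conclusion: for every `k ≥ 1`, the `k`-fold convolution power `f_ζ^k` is supported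
on the single double coset `J̄_P ζ^k J̄_P`.
-/
theorem lemma_2_13
    {G : Type*} [Group G]
    (JP L U Um : Subgroup G)
    (w1 w2 : G) (ζ : G) (hζ : ζ = w1 * w2)
    {𝓗 : Type*} [Ring 𝓗] [Algebra ℂ 𝓗] (hd : HeckeData G JP 𝓗)
    (fζ : 𝓗)
    (hfζ : hd.supp fζ ⊆ (JP : Set G) * {ζ} * (JP : Set G))
    -- Iwahori decomposition of `J̄_P` with respect to `(L̄, P̄)`
    (hIw : (JP : Set G) ⊆
      ((JP ⊓ Um : Subgroup G) : Set G) * ((JP ⊓ L : Subgroup G) : Set G) *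
        ((JP ⊓ U : Subgroup G) : Set G))
    (hc1 : ∀ x ∈ JP ⊓ Um, ζ * x * ζ⁻¹ ∈ JP)
    (hc2 : ∀ x ∈ JP ⊓ L, ζ * x * ζ⁻¹ ∈ JP)
    (hc3 : ∀ k : ℕ, ∀ x ∈ JP ⊓ U, (ζ ^ k)⁻¹ * x * ζ ^ k ∈ JP) :
    ∀ k : ℕ, 0 < k →
      hd.supp (fζ ^ k) ⊆ (JP : Set G) * {ζ ^ k} * (JP : Set G) := by
  intro k hk
  induction k, hk using Nat.le_induction with
  | base => simpa using hfζ
  | succ k _ ih =>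
    rw [pow_succ']
    refine (hd.supp_mul fζ (fζ ^ k)).trans ?_
    rintro _ ⟨x, hx, y, hy, rfl⟩
    obtain ⟨_, ⟨a, ha, z, hz, rfl⟩, b, hb, rfl⟩ := hfζ hx
    rw [Set.mem_singleton_iff] at hz
    subst z
    obtain ⟨_, ⟨c, hc, _, rfl, rfl⟩, d, hd', rfl⟩ := ih hy
    obtain ⟨_, ⟨n, hn, l, hl, rfl⟩, u, hu, hbc⟩ := hIw (JP.mul_mem hb hc)
    have hbc : n * l * u = b * c := hbc
    refine ⟨_, ⟨a * (ζ * n * ζ⁻¹) * (ζ * l * ζ⁻¹),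
      JP.mul_mem (JP.mul_mem ha (hc1 n hn)) (hc2 l hl), _, rfl, rfl⟩,
      (ζ ^ k)⁻¹ * u * ζ ^ k * d, JP.mul_mem (hc3 k u hu) hd', ?_⟩
    calc a * (ζ * n * ζ⁻¹) * (ζ * l * ζ⁻¹) * ζ ^ (k + 1) * ((ζ ^ k)⁻¹ * u * ζ ^ k * d)
        = a * ζ * (n * l * u) * ζ ^ k * d := by
          rw [pow_succ']; group
      _ = a * ζ * b * (c * ζ ^ k * d) := by
          rw [hbc]; simp only [mul_assoc]
end
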